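/- The function k_ε is continuously differentiable on [−1,1] (with one-sided derivatives at the endpoints), nonnegative, even, satisfies k_ε(−1) = k_ε(1) = 0, and for all y ∈ [−1,1]: k_ε(y) ≤ (2+γ)ε^{1+γ}, |k_ε'(y)| ≤ (1+γ)·max(1,c)·ε^γ, and k_ε(y) ≤ (1+γ)ε^γ |y|. -/

import Mathlib

open Set

/-- The constant `c = (1+γ)ε / ((1+γ) − ε(1+2γ))`. -/
noncomputable def kepsConst (γ ε : ℝ) : ℝ :=
  (1 + γ) * ε / ((1 + γ) - ε * (1 + 2 * γ))

/-- The even perturbation function `k_ε` on `[−1,1]`, defined on `[0,1]` by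
`y^{1+γ}` on `[0,ε]`, by `ε^{1+γ} + (1+γ)ε^γ(y−ε) − (1+c)(y−ε)^{1+γ}` on `[ε,2ε]`,
and by `(1+γ−c)ε^{1+γ} − c(1+γ)ε^γ(y−2ε)` on `[2ε,1]`. -/
noncomputable def keps (γ ε : ℝ) (y : ℝ) : ℝ :=
  if |y| ≤ ε then |y| ^ (1 + γ)
  else if |y| ≤ 2 * ε then
    ε ^ (1 + γ) + (1 + γ) * ε ^ γ * (|y| - ε) - (1 + kepsConst γ ε) * (|y| - ε) ^ (1 + γ)
  else (1 + γ - kepsConst γ ε) * ε ^ (1 + γ) - kepsConst γ ε * (1 + γ) * ε ^ γ * (|y| - 2 * ε)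

noncomputable def auxPsi (γ ε x : ℝ) : ℝ := (1 + γ) * (min (max x 0) ε) ^ γ

noncomputable def auxPhi (γ ε x : ℝ) : ℝ := ∫ t in (0:ℝ)..x, auxPsi γ ε t

lemma auxPsi_cont (γ ε : ℝ) (hγ : 0 < γ) : Continuous (auxPsi γ ε) := by
  unfold auxPsi
  refine continuous_const.mul (Continuous.rpow_const (by fun_prop) ?_)
  intro x; right; exact hγ.le

lemma auxPhi_deriv (γ ε : ℝ) (hγ : 0 < γ) (x : ℝ) :
    HasDerivAt (auxPhi γ ε) (auxPsi γ ε x) x :=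
  intervalIntegral.integral_hasDerivAt_right
    ((auxPsi_cont γ ε hγ).intervalIntegrable _ _)
    ((auxPsi_cont γ ε hγ).stronglyMeasurableAtFilter _ _)
    (auxPsi_cont γ ε hγ).continuousAt

lemma auxPsi_neg (γ ε x : ℝ) (hγ : 0 < γ) (hε : 0 < ε) (hx : x ≤ 0) : auxPsi γ ε x = 0 := by
  unfold auxPsi
  rw [max_eq_right hx, min_eq_left hε.le, Real.zero_rpow hγ.ne', mul_zero]

lemma auxPsi_mid (γ ε x : ℝ) (hx : 0 ≤ x) (hx' : x ≤ ε) :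
    auxPsi γ ε x = (1 + γ) * x ^ γ := by
  unfold auxPsi
  rw [max_eq_left hx, min_eq_left hx']

lemma auxPsi_big (γ ε x : ℝ) (hε : 0 < ε) (hx : ε ≤ x) :
    auxPsi γ ε x = (1 + γ) * ε ^ γ := by
  unfold auxPsi
  rw [max_eq_left (hε.le.trans hx), min_eq_right hx]

lemma auxPsi_bd (γ ε x : ℝ) (hγ : 0 < γ) (hε : 0 < ε) :
    0 ≤ auxPsi γ ε x ∧ auxPsi γ ε x ≤ (1 + γ) * ε ^ γ := by
  unfold auxPsi
  have h : 0 ≤ min (max x 0) ε := le_min (le_max_right _ _) hε.le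
  refine ⟨by positivity, ?_⟩
  have := Real.rpow_le_rpow h (min_le_right _ _) hγ.le
  gcongr

lemma auxPhi_neg (γ ε x : ℝ) (hγ : 0 < γ) (hε : 0 < ε) (hx : x ≤ 0) : auxPhi γ ε x = 0 := by
  unfold auxPhi
  rw [intervalIntegral.integral_congr (g := fun _ => (0:ℝ))]
  · simp
  · intro t ht
    rw [uIcc_of_ge hx] at ht
    exact auxPsi_neg γ ε t hγ hε ht.2

lemma auxPhi_mid (γ ε x : ℝ) (hγ : 0 < γ) (hx : 0 ≤ x) (hx' : x ≤ ε) :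
    auxPhi γ ε x = x ^ (1 + γ) := by
  unfold auxPhi
  rw [intervalIntegral.integral_congr (g := fun t => (1 + γ) * t ^ γ)]
  · rw [intervalIntegral.integral_const_mul, integral_rpow (Or.inl (by linarith)),
      Real.zero_rpow (by linarith), add_comm γ 1]
    field_simp
    ring
  · intro t ht
    rw [uIcc_of_le hx] at ht
    exact auxPsi_mid γ ε t ht.1 (ht.2.trans hx')

lemma auxPhi_big (γ ε x : ℝ) (hγ : 0 < γ) (hε : 0 < ε) (hx : ε ≤ x) :
    auxPhi γ ε x = ε ^ (1 + γ) + (1 + γ) * ε ^ γ * (x - ε) := by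
  rw [← auxPhi_mid γ ε ε hγ hε.le le_rfl]
  unfold auxPhi
  rw [← intervalIntegral.integral_add_adjacent_intervals (b := ε)
    ((auxPsi_cont γ ε hγ).intervalIntegrable _ _) ((auxPsi_cont γ ε hγ).intervalIntegrable _ _)]
  congr 1
  rw [intervalIntegral.integral_congr (g := fun _ => (1 + γ) * ε ^ γ)]
  · simp; ring
  · intro t ht
    rw [uIcc_of_le hx] at ht
    exact auxPsi_big γ ε t hε ht.1

lemma keps_even (γ ε y : ℝ) : keps γ ε (-y) = keps γ ε y := by
  simp [keps]

lemma rpow_split (γ ε : ℝ) (hε : 0 < ε) : ε ^ (1 + γ) = ε * ε ^ γ := by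
  rw [Real.rpow_add hε, Real.rpow_one]

noncomputable def auxK (γ ε y : ℝ) : ℝ :=
  auxPhi γ ε y + auxPhi γ ε (-y)
    - (1 + kepsConst γ ε) * (auxPhi γ ε (y - ε) + auxPhi γ ε (-y - ε))

noncomputable def auxG (γ ε y : ℝ) : ℝ :=
  auxPsi γ ε y - auxPsi γ ε (-y)
    - (1 + kepsConst γ ε) * (auxPsi γ ε (y - ε) - auxPsi γ ε (-y - ε))

lemma keps_eq_aux (γ ε y : ℝ) (hγ : 0 < γ) (hε : 0 < ε) (hy : 0 ≤ y) :
    keps γ ε y = auxK γ ε y := by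
  unfold keps auxK
  rw [abs_of_nonneg hy, auxPhi_neg γ ε (-y) hγ hε (by linarith),
    auxPhi_neg γ ε (-y - ε) hγ hε (by linarith)]
  split_ifs with h1 h2
  · rw [auxPhi_mid γ ε y hγ hy h1, auxPhi_neg γ ε (y - ε) hγ hε (by linarith)]
    ring
  · push Not at h1
    rw [auxPhi_big γ ε y hγ hε h1.le, auxPhi_mid γ ε (y - ε) hγ (by linarith) (by linarith)]
    ring
  · push Not at h1 h2
    rw [auxPhi_big γ ε y hγ hε h1.le, auxPhi_big γ ε (y - ε) hγ hε (by linarith),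
      rpow_split γ ε hε]
    ring

lemma keps_eq (γ ε : ℝ) (hγ : 0 < γ) (hε : 0 < ε) : keps γ ε = auxK γ ε := by
  funext y
  rcases le_total 0 y with hy | hy
  · exact keps_eq_aux γ ε y hγ hε hy
  · rw [← keps_even, keps_eq_aux γ ε (-y) hγ hε (by linarith)]
    unfold auxK
    rw [neg_neg]
    ring

lemma keps_deriv (γ ε : ℝ) (hγ : 0 < γ) (hε : 0 < ε) (y : ℝ) :
    HasDerivAt (keps γ ε) (auxG γ ε y) y := by
  rw [keps_eq γ ε hγ hε]
  have hn : HasDerivAt (fun y : ℝ => -y) (-1) y := hasDerivAt_neg y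
  have h1 := auxPhi_deriv γ ε hγ y
  have h2 := (auxPhi_deriv γ ε hγ (-y)).comp y hn
  have h3 := (auxPhi_deriv γ ε hγ (y - ε)).comp y ((hasDerivAt_id y).sub_const ε)
  have h4 := (auxPhi_deriv γ ε hγ (-y - ε)).comp y (hn.sub_const ε)
  have := (h1.add h2).sub ((h3.add h4).const_mul (1 + kepsConst γ ε))
  refine this.congr_deriv ?_
  unfold auxG
  ring

lemma auxG_cont (γ ε : ℝ) (hγ : 0 < γ) : Continuous (auxG γ ε) := by
  have := auxPsi_cont γ ε hγ
  unfold auxG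
  fun_prop

lemma const_bd (γ ε : ℝ) (hγ : 0 < γ) (hε : ε ∈ Ioo (0 : ℝ) (1 / 2)) :
    0 < kepsConst γ ε ∧ kepsConst γ ε < 1 + γ ∧
    kepsConst γ ε * ((1 + γ) - ε * (1 + 2 * γ)) = (1 + γ) * ε := by
  obtain ⟨h0, h1⟩ := hε
  have hD : 0 < (1 + γ) - ε * (1 + 2 * γ) := by nlinarith
  unfold kepsConst
  refine ⟨by positivity, ?_, div_mul_cancel₀ _ hD.ne'⟩
  rw [div_lt_iff₀ hD]
  nlinarith [mul_pos hγ hγ]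

lemma auxG_bd (γ ε y : ℝ) (hγ : 0 < γ) (hε : ε ∈ Ioo (0 : ℝ) (1 / 2)) (hy : 0 ≤ y) :
    |auxG γ ε y| ≤ (1 + γ) * max 1 (kepsConst γ ε) * ε ^ γ := by
  obtain ⟨c0, -, -⟩ := const_bd γ ε hγ hε
  obtain ⟨h0, h1⟩ := hε
  have hM : (0:ℝ) < (1 + γ) * ε ^ γ := by positivity
  have e : (1 + γ) * max 1 (kepsConst γ ε) * ε ^ γ
      = max 1 (kepsConst γ ε) * ((1 + γ) * ε ^ γ) := by ring
  have m1 := mul_le_mul_of_nonneg_right (le_max_left 1 (kepsConst γ ε)) hM.le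
  have m2 := mul_le_mul_of_nonneg_right (le_max_right 1 (kepsConst γ ε)) hM.le
  rw [e]
  unfold auxG
  rw [auxPsi_neg γ ε (-y) hγ h0 (by linarith), auxPsi_neg γ ε (-y - ε) hγ h0 (by linarith)]
  rcases le_total y ε with h | h
  · rw [auxPsi_neg γ ε (y - ε) hγ h0 (by linarith)]
    obtain ⟨b0, b1⟩ := auxPsi_bd γ ε y hγ h0
    rw [abs_le]; constructor <;> linarith
  · rw [auxPsi_big γ ε y h0 h]
    obtain ⟨b0, b1⟩ := auxPsi_bd γ ε (y - ε) hγ h0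
    have b2 := mul_le_mul_of_nonneg_left b1 (by linarith : 0 ≤ 1 + kepsConst γ ε)
    have b3 := mul_nonneg (by linarith : 0 ≤ 1 + kepsConst γ ε) b0
    rw [abs_le]; constructor <;> linarith

lemma auxG_bd' (γ ε y : ℝ) (hγ : 0 < γ) (hε : ε ∈ Ioo (0 : ℝ) (1 / 2)) :
    |auxG γ ε y| ≤ (1 + γ) * max 1 (kepsConst γ ε) * ε ^ γ := by
  rcases le_total 0 y with hy | hy
  · exact auxG_bd γ ε y hγ hε hy
  · have h := auxG_bd γ ε (-y) hγ hε (by linarith)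
    have e : auxG γ ε (-y) = - auxG γ ε y := by
      unfold auxG; rw [neg_neg]; ring
    rwa [e, abs_neg] at h

lemma keps_bds (γ ε y : ℝ) (hγ : 0 < γ) (hε : ε ∈ Ioo (0 : ℝ) (1 / 2)) (hy : |y| ≤ 1) :
    0 ≤ keps γ ε y ∧ keps γ ε y ≤ (2 + γ) * ε ^ (1 + γ) ∧
      keps γ ε y ≤ (1 + γ) * ε ^ γ * |y| := by
  obtain ⟨c0, c1, c2⟩ := const_bd γ ε hγ hε
  obtain ⟨h0, h1⟩ := hε
  have hz := abs_nonneg y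
  unfold keps
  generalize |y| = z at *
  generalize kepsConst γ ε = c at *
  have hE : 0 < ε ^ γ := by positivity
  rw [rpow_split γ ε h0]
  split_ifs with ha hb
  · have hs : z ^ (1 + γ) = z * z ^ γ := by
      rw [Real.rpow_add' hz (by linarith), Real.rpow_one]
    have hz' : 0 ≤ z ^ γ := by positivity
    have hle : z ^ γ ≤ ε ^ γ := Real.rpow_le_rpow hz ha hγ.le
    rw [hs]
    have i1 : z * z ^ γ ≤ z * ε ^ γ := by gcongr
    have i2 : z * ε ^ γ ≤ ε * ε ^ γ := by gcongr
    have i3 : 0 < ε * ε ^ γ := by positivity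
    have i4 : 0 ≤ z * ε ^ γ := by positivity
    refine ⟨by positivity, ?_, ?_⟩ <;> nlinarith
  · push Not at ha
    obtain ⟨t, rfl⟩ : ∃ t, z = t + ε := ⟨z - ε, by ring⟩
    have ht : 0 < t := by linarith
    have ht' : t ≤ ε := by linarith
    rw [add_sub_cancel_right, rpow_split γ t ht]
    have hle : t ^ γ ≤ ε ^ γ := Real.rpow_le_rpow ht.le ht' hγ.le
    have i1 : (1 + c) * (t * t ^ γ) ≤ (1 + c) * (t * ε ^ γ) := by gcongr
    have i0 : 0 ≤ (1 + c) * (t * t ^ γ) := by positivity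
    have i2 : t * ε ^ γ ≤ ε * ε ^ γ := by gcongr
    have i3 : (1 + γ) * (t * ε ^ γ) ≤ (1 + γ) * (ε * ε ^ γ) := by gcongr
    have i4 : c * (t * ε ^ γ) ≤ (1 + γ) * (t * ε ^ γ) := by gcongr
    have i5 : 0 < γ * (ε * ε ^ γ) := by positivity
    refine ⟨?_, ?_, ?_⟩ <;> linarith
  · push Not at ha hb
    have key : (1 + γ - c) * (ε * ε ^ γ) - c * (1 + γ) * ε ^ γ * (z - 2 * ε)
        = c * (1 + γ) * ε ^ γ * (1 - z) := by
      linear_combination (-ε ^ γ) * c2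
    have i1 : 0 ≤ c * (1 + γ) * ε ^ γ * (z - 2 * ε) :=
      mul_nonneg (by positivity) (by linarith)
    have i2 : 0 < ε * ε ^ γ := by positivity
    have i3 : 0 < c * (ε * ε ^ γ) := by positivity
    have i4 : (1 + γ) * ε ^ γ * ε ≤ (1 + γ) * ε ^ γ * z := by gcongr
    refine ⟨?_, ?_, ?_⟩
    · rw [key]
      exact mul_nonneg (by positivity) (by linarith)
    · linarith
    · linarith

lemma keps_one (γ ε : ℝ) (hγ : 0 < γ) (hε : ε ∈ Ioo (0 : ℝ) (1 / 2)) : keps γ ε 1 = 0 := by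
  obtain ⟨c0, c1, c2⟩ := const_bd γ ε hγ hε
  obtain ⟨h0, h1⟩ := hε
  unfold keps
  rw [abs_one, if_neg (by linarith), if_neg (by linarith), rpow_split γ ε h0]
  linear_combination (-ε ^ γ) * c2

/-- The function `k_ε` is `C¹` on `[−1,1]`, nonnegative there, even, vanishes at `±1`, and
satisfies `k_ε(y) ≤ (2+γ)ε^{1+γ}`, `|k_ε'(y)| ≤ (1+γ) max(1,c) ε^γ` and
`k_ε(y) ≤ (1+γ)ε^γ |y|` on `[−1,1]`. -/
theorem keps_properties (γ ε : ℝ) (hγ : 0 < γ) (hε : ε ∈ Ioo (0 : ℝ) (1 / 2)) :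
    ContDiffOn ℝ 1 (keps γ ε) (Icc (-1 : ℝ) 1) ∧
    (∀ y ∈ Icc (-1 : ℝ) 1, 0 ≤ keps γ ε y) ∧
    (∀ y : ℝ, keps γ ε (-y) = keps γ ε y) ∧
    keps γ ε (-1) = 0 ∧ keps γ ε 1 = 0 ∧
    ∀ y ∈ Icc (-1 : ℝ) 1,
      keps γ ε y ≤ (2 + γ) * ε ^ (1 + γ) ∧
      |derivWithin (keps γ ε) (Icc (-1 : ℝ) 1) y| ≤ (1 + γ) * max 1 (kepsConst γ ε) * ε ^ γ ∧
      keps γ ε y ≤ (1 + γ) * ε ^ γ * |y| := by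
  have hd := keps_deriv γ ε hγ hε.1
  refine ⟨?_, ?_, keps_even γ ε, ?_, keps_one γ ε hγ hε, ?_⟩
  · refine ContDiff.contDiffOn ?_
    rw [contDiff_one_iff_deriv]
    refine ⟨fun y => (hd y).differentiableAt, ?_⟩
    rw [show deriv (keps γ ε) = auxG γ ε from funext fun y => (hd y).deriv]
    exact auxG_cont γ ε hγ
  · intro y hy
    exact (keps_bds γ ε y hγ hε (abs_le.2 hy)).1
  · rw [keps_even]; exact keps_one γ ε hγ hε
  · intro y hy
    obtain ⟨-, b1, b2⟩ := keps_bds γ ε y hγ hε (abs_le.2 hy)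
    refine ⟨b1, ?_, b2⟩
    rw [(hd y).hasDerivWithinAt.derivWithin
      (uniqueDiffOn_Icc (by norm_num : (-1:ℝ) < 1) y hy)]
    exact auxG_bd' γ ε y hγ hε
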